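/- arXiv:1512.05422 — 8 statements merged into one kernel-verified Lean document; each statement's English description precedes it below -/
import Mathlib

section
/- Let P be a finite type, let s be a nonempty subset of P, and set α = Σ_{p ∈ s} y_p ∈ Λ. Then the kernel of the ℤ-linear map Λ → Λ given by left multiplication by α is equal to its range. (This exactness of wedge multiplication by a sum of basis generators is the key computation in the paper's determination of the Khovanov homology of a pointed unlink: the homology of the one-component complex Λ →(α·) Λ is αΛ in degree 0 and Λ/αΛ in degree 1.) -/
noncomputable section

/-- The exterior algebra over `ℤ` on the free module with basis `P`. -/
abbrev Lam (P : Type) : Type := ExteriorAlgebra ℤ (P →₀ ℤ)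

/-- The generator `y_p` of the exterior algebra. -/
def yGen {P : Type} (p : P) : Lam P := ExteriorAlgebra.ι ℤ (Finsupp.single p 1)

/-- If some linear form takes the value `1` at `v`, then contraction with it is a contracting
homotopy, so that left multiplication by `v` on the exterior algebra is exact. -/
theorem ExteriorAlgebra.ker_mulLeft_ι_eq_range {R M : Type*} [CommRing R] [AddCommGroup M]
    [Module R M] {v : M} {d : Module.Dual R M} (hd : d v = 1) :
    LinearMap.ker (LinearMap.mulLeft R (ExteriorAlgebra.ι R v)) =
      LinearMap.range (LinearMap.mulLeft R (ExteriorAlgebra.ι R v)) := by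
  ext x
  simp only [LinearMap.mem_ker, LinearMap.mem_range, LinearMap.mulLeft_apply]
  constructor
  · intro hx
    refine ⟨CliffordAlgebra.contractLeft d x, ?_⟩
    have h := CliffordAlgebra.contractLeft_ι_mul (Q := (0 : QuadraticForm R M)) (d := d) v x
    rw [hd, one_smul] at h
    exact (sub_eq_zero.mp (h.symm.trans ((congrArg _ hx).trans (map_zero _)))).symm
  · rintro ⟨y, rfl⟩
    rw [← mul_assoc, ExteriorAlgebra.ι_sq_zero, zero_mul]

/-- for a nonempty finite set `s` of basepoints and
`α = Σ_{p ∈ s} y_p`, the kernel of left multiplication by `α` on the exterior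
algebra equals its range. -/
theorem ker_mulLeft_alpha_eq_range (P : Type) [Fintype P] (s : Finset P) (hs : s.Nonempty) :
    LinearMap.ker (LinearMap.mulLeft ℤ (∑ p ∈ s, yGen p)) =
      LinearMap.range (LinearMap.mulLeft ℤ (∑ p ∈ s, yGen p)) := by
  classical
  obtain ⟨q, hq⟩ := hs
  simp only [yGen, ← map_sum]
  apply ExteriorAlgebra.ker_mulLeft_ι_eq_range (d := Finsupp.lapply q)
  simp [Finsupp.single_apply, hq]
end
end

section
/- Let P be a finite type, let s be a nonempty subset of P, and set α = Σ_{p ∈ s} y_p ∈ Λ. Then the quotient of Λ by the two-sided ideal generated by α is a free ℤ-module of rank 2^{card P − 1}. (In the paper this quotient is the algebra Λ_{p,L} for a one-component pointed unlink, identified with an exterior algebra on one fewer generator.) -/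
noncomputable section

/-- The two-sided ideal generated by an element `a` of a (possibly noncommutative)
`ℤ`-algebra, as a `ℤ`-submodule: the span of all products `x * a * y`. -/
def twoSidedSpan {Λ : Type} [Ring Λ] (a : Λ) : Submodule ℤ Λ :=
  Submodule.span ℤ {z | ∃ x y : Λ, z = x * a * y}

section TwoSidedSpan

variable {Λ : Type} [Ring Λ] {a x : Λ}

theorem self_mem_twoSidedSpan (a : Λ) : a ∈ twoSidedSpan a :=
  Submodule.subset_span ⟨1, 1, by simp⟩

theorem mul_mem_twoSidedSpan_left (y : Λ) (hx : x ∈ twoSidedSpan a) : y * x ∈ twoSidedSpan a := by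
  induction hx using Submodule.span_induction with
  | mem z hz =>
    obtain ⟨u, v, rfl⟩ := hz
    exact Submodule.subset_span ⟨y * u, v, by simp only [mul_assoc]⟩
  | zero => simp
  | add u v _ _ hu hv => rw [mul_add]; exact add_mem hu hv
  | smul n u _ hu => rw [mul_smul_comm]; exact Submodule.smul_mem _ n hu

theorem mul_mem_twoSidedSpan_right (y : Λ) (hx : x ∈ twoSidedSpan a) : x * y ∈ twoSidedSpan a := by
  induction hx using Submodule.span_induction with
  | mem z hz =>
    obtain ⟨u, v, rfl⟩ := hz
    exact Submodule.subset_span ⟨u, v * y, by simp only [mul_assoc]⟩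
  | zero => simp
  | add u v _ _ hu hv => rw [add_mul]; exact add_mem hu hv
  | smul n u _ hu => rw [smul_mul_assoc]; exact Submodule.smul_mem _ n hu

theorem twoSidedSpan_le_ker {Γ : Type} [Ring Γ] (φ : Λ →+* Γ) (ha : φ a = 0) :
    twoSidedSpan a ≤ LinearMap.ker φ.toAddMonoidHom.toIntLinearMap :=
  Submodule.span_le.2 <| by
    rintro _ ⟨u, v, rfl⟩
    simp [ha]

end TwoSidedSpan

section SplitQuotient

variable {M N : Type} [AddCommGroup M] [AddCommGroup N]
  {f : M →ₗ[ℤ] N} {g : N →ₗ[ℤ] M} {a : M} {c : M →ₗ[ℤ] ℤ}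

theorem sub_map_map_mem_twoSidedSpan (hgf : ∀ m, g (f m) = m - c m • a)
    (x : ExteriorAlgebra ℤ M) :
    x - ExteriorAlgebra.map g (ExteriorAlgebra.map f x) ∈
      twoSidedSpan (ExteriorAlgebra.ι ℤ a) := by
  induction x using ExteriorAlgebra.induction with
  | algebraMap r => simp
  | ι m =>
    have h : ExteriorAlgebra.ι ℤ m - ExteriorAlgebra.ι ℤ (g (f m)) =
        c m • ExteriorAlgebra.ι ℤ a := by
      rw [hgf, ← map_sub, sub_sub_cancel, map_zsmul]
    rw [ExteriorAlgebra.map_apply_ι, ExteriorAlgebra.map_apply_ι, h]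
    exact zsmul_mem (self_mem_twoSidedSpan _) _
  | mul x y hx hy =>
    rw [map_mul, map_mul, ← sub_add_sub_cancel _
      (ExteriorAlgebra.map g (ExteriorAlgebra.map f x) * y) _, ← sub_mul, ← mul_sub]
    exact add_mem (mul_mem_twoSidedSpan_right _ hx) (mul_mem_twoSidedSpan_left _ hy)
  | add x y hx hy =>
    rw [map_add, map_add, add_sub_add_comm]
    exact add_mem hx hy

theorem ker_map_eq_twoSidedSpan (hfa : f a = 0) (hgf : ∀ m, g (f m) = m - c m • a) :
    LinearMap.ker (ExteriorAlgebra.map f).toRingHom.toAddMonoidHom.toIntLinearMap =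
      twoSidedSpan (ExteriorAlgebra.ι ℤ a) := by
  refine le_antisymm (fun x hx => ?_) (twoSidedSpan_le_ker _ ?_)
  · have hx' : ExteriorAlgebra.map f x = 0 := hx
    simpa [hx'] using sub_map_map_mem_twoSidedSpan hgf x
  · change ExteriorAlgebra.map f (ExteriorAlgebra.ι ℤ a) = 0
    rw [ExteriorAlgebra.map_apply_ι, hfa, map_zero]

/-- If `f` is a split surjection with kernel spanned by `a`, then killing `ι a` in the exterior
algebra of the source gives the exterior algebra of the target. -/
def quotientTwoSidedSpanEquiv (hfa : f a = 0) (hfg : ∀ n, f (g n) = n)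
    (hgf : ∀ m, g (f m) = m - c m • a) :
    (ExteriorAlgebra ℤ M ⧸ twoSidedSpan (ExteriorAlgebra.ι ℤ a)) ≃ₗ[ℤ] ExteriorAlgebra ℤ N :=
  (Submodule.quotEquivOfEq _ _ (ker_map_eq_twoSidedSpan hfa hgf).symm).trans <|
    LinearMap.quotKerEquivOfSurjective _ <|
      ExteriorAlgebra.map_surjective_iff.2 fun n => ⟨g n, hfg n⟩

end SplitQuotient

theorem nonempty_quotient_twoSidedSpan_equiv {P : Type} {a : P →₀ ℤ} {p₀ : P} (ha : a p₀ = 1) :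
    Nonempty ((Lam P ⧸ twoSidedSpan (ExteriorAlgebra.ι ℤ a)) ≃ₗ[ℤ] Lam {p // p ≠ p₀}) := by
  let c : (P →₀ ℤ) →ₗ[ℤ] ℤ := Finsupp.lapply p₀
  let f : (P →₀ ℤ) →ₗ[ℤ] ({p // p ≠ p₀} →₀ ℤ) :=
    Finsupp.lsubtypeDomain {p | p ≠ p₀} ∘ₗ (LinearMap.id - c.smulRight a)
  let g : ({p // p ≠ p₀} →₀ ℤ) →ₗ[ℤ] (P →₀ ℤ) := Finsupp.lmapDomain ℤ ℤ Subtype.val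
  have g_val (n : {p // p ≠ p₀} →₀ ℤ) (p : {p // p ≠ p₀}) : g n p = n p :=
    Finsupp.mapDomain_apply Subtype.val_injective n p
  have g_p₀ (n : {p // p ≠ p₀} →₀ ℤ) : g n p₀ = 0 :=
    Finsupp.mapDomain_of_notMem_range n p₀ (by simp)
  have f_apply (m : P →₀ ℤ) (p : {p // p ≠ p₀}) : f m p = m p - m p₀ * a p := rfl
  refine ⟨quotientTwoSidedSpanEquiv (f := f) (g := g) (c := c) ?_ (fun n => ?_) (fun m => ?_)⟩
  · ext p
    simp [f_apply, ha]
  · ext p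
    simp [f_apply, g_val, g_p₀]
  · ext p
    by_cases hp : p = p₀
    · subst hp
      simp [g_p₀, c, ha]
    · simpa [c] using (g_val (f m) ⟨p, hp⟩).trans (f_apply m ⟨p, hp⟩)

theorem free_and_rank_lam (P : Type) [Fintype P] :
    Module.Free ℤ (Lam P) ∧ Module.rank ℤ (Lam P) = 2 ^ Fintype.card P := by
  let : LinearOrder P := IsWellOrder.linearOrder WellOrderingRel
  let b : Module.Basis (Finset P) ℤ (Lam P) :=
    (Finsupp.basisSingleOne : Module.Basis P ℤ (P →₀ ℤ)).ExteriorAlgebra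
  refine ⟨Module.Free.of_basis b, ?_⟩
  rw [rank_eq_card_basis b, Fintype.card_finset]
  push_cast
  rfl

/-- for a nonempty finite set `s` of basepoints and `α = Σ_{p ∈ s} y_p`,
the quotient of the exterior algebra by the two-sided ideal generated by `α` is a free
`ℤ`-module of rank `2 ^ (card P - 1)`. -/
theorem quotient_twoSided_alpha_free (P : Type) [Fintype P] (s : Finset P) (hs : s.Nonempty) :
    Module.Free ℤ (Lam P ⧸ twoSidedSpan (∑ p ∈ s, yGen p)) ∧
      Module.rank ℤ (Lam P ⧸ twoSidedSpan (∑ p ∈ s, yGen p)) =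
        2 ^ (Fintype.card P - 1) := by
  classical
  obtain ⟨p₀, hp₀⟩ := hs
  have hα : ∑ p ∈ s, yGen p = ExteriorAlgebra.ι ℤ (∑ p ∈ s, Finsupp.single p (1 : ℤ)) :=
    (map_sum _ _ _).symm
  have ha : (∑ p ∈ s, Finsupp.single p (1 : ℤ)) p₀ = 1 := by
    simp [Finsupp.finsetSum_apply, Finsupp.single_apply, hp₀]
  obtain ⟨e⟩ := nonempty_quotient_twoSidedSpan_equiv ha
  obtain ⟨hfree, hrank⟩ := free_and_rank_lam {p // p ≠ p₀}
  rw [hα]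
  refine ⟨Module.Free.of_equiv e.symm, ?_⟩
  rw [e.rank_eq, hrank, Fintype.card_subtype_compl, Fintype.card_subtype_eq]
end
end

section
/- Let P be a nonempty finite type, let k ≥ 1, and let π : P → Fin k be surjective. Then the quotient of Λ by the two-sided ideal generated by α_0, …, α_{k−1} is a free ℤ-module of rank 2^{card P − k}. (In the paper this quotient is the algebra Λ_{p,L} associated to a non-degenerate k-component pointed unlink with basepoint set p = P.) -/
noncomputable section

/-- `α_i = Σ_{p : π p = i} y_p`. -/
def alph {P : Type} [Fintype P] {k : ℕ} (π : P → Fin k) (i : Fin k) : Lam P :=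
  ∑ p : P, if π p = i then yGen p else 0

/-- The two-sided ideal generated by a set `S` of elements of a (possibly noncommutative)
`ℤ`-algebra, as a `ℤ`-submodule: the span of all products `x * a * y` with `a ∈ S`. -/
def twoSidedSpanSet {Λ : Type} [Ring Λ] (S : Set Λ) : Submodule ℤ Λ :=
  Submodule.span ℤ {z | ∃ a ∈ S, ∃ x y : Λ, z = x * a * y}

theorem mem_twoSidedSpanSet_of_mem {Λ : Type} [Ring Λ] {S : Set Λ} {a : Λ} (ha : a ∈ S) :
    a ∈ twoSidedSpanSet S :=
  Submodule.subset_span ⟨a, ha, 1, 1, by simp⟩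

theorem mul_mem_twoSidedSpanSet {Λ : Type} [Ring Λ] {S : Set Λ} (b c : Λ) {z : Λ}
    (hz : z ∈ twoSidedSpanSet S) : b * z * c ∈ twoSidedSpanSet S := by
  induction hz using Submodule.span_induction with
  | mem z hz =>
    obtain ⟨a, ha, x, y, rfl⟩ := hz
    exact Submodule.subset_span ⟨a, ha, b * x, y * c, by simp only [mul_assoc]⟩
  | zero => simp
  | add z w _ _ hz hw => simpa only [mul_add, add_mul] using add_mem hz hw
  | smul n z _ hz => simpa only [mul_smul_comm, smul_mul_assoc] using Submodule.smul_mem _ n hz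

/-- If `f` kills `S` and `g` inverts `f` modulo the span of `S`, then the two-sided ideal generated
by `S` is the kernel of the map of exterior algebras induced by `f`. -/
theorem mem_twoSidedSpanSet_iff_map_eq_zero {M N : Type} [AddCommGroup M] [AddCommGroup N]
    (f : M →ₗ[ℤ] N) (g : N →ₗ[ℤ] M) {S : Set M} (hS : ∀ m ∈ S, f m = 0)
    (hfg : ∀ m, m - g (f m) ∈ Submodule.span ℤ S) (x : ExteriorAlgebra ℤ M) :
    x ∈ twoSidedSpanSet (ExteriorAlgebra.ι ℤ '' S) ↔ ExteriorAlgebra.map f x = 0 := by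
  constructor
  · intro hx
    induction hx using Submodule.span_induction with
    | mem z hz =>
      obtain ⟨_, ⟨m, hm, rfl⟩, x, y, rfl⟩ := hz
      simp [hS m hm]
    | zero => simp
    | add z w _ _ hz hw => simp [hz, hw]
    | smul n z _ hz => rw [map_zsmul, hz, smul_zero]
  · intro hx
    suffices h : x - ExteriorAlgebra.map g (ExteriorAlgebra.map f x) ∈
        twoSidedSpanSet (ExteriorAlgebra.ι ℤ '' S) by simpa [hx] using h
    clear hx
    induction x using ExteriorAlgebra.induction with
    | algebraMap r => simp
    | ι m =>
      rw [ExteriorAlgebra.map_apply_ι, ExteriorAlgebra.map_apply_ι, ← map_sub]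
      have h := hfg m
      generalize m - g (f m) = d at h
      induction h using Submodule.span_induction with
      | mem z hz => exact mem_twoSidedSpanSet_of_mem ⟨z, hz, rfl⟩
      | zero => simp
      | add z w _ _ hz hw => rw [map_add]; exact add_mem hz hw
      | smul n z _ hz => rw [map_zsmul]; exact zsmul_mem hz n
    | mul a b ha hb =>
      rw [map_mul, map_mul]
      have h := add_mem (mul_mem_twoSidedSpanSet 1 b ha)
        (mul_mem_twoSidedSpanSet (ExteriorAlgebra.map g (ExteriorAlgebra.map f a)) 1 hb)
      convert h using 1
      noncomm_ring
    | add a b ha hb =>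
      rw [map_add, map_add, add_sub_add_comm]
      exact add_mem ha hb

/-- The sums of basis vectors over the fibres of a surjection `π` cut out a free quotient, with
basis the complement of a section of `π`. -/
theorem exists_split_fiberSums {P : Type} [Fintype P] [DecidableEq P] {k : ℕ} {π : P → Fin k}
    {s : Fin k → P} (hs : ∀ i, π (s i) = i) :
    ∃ (f : (P →₀ ℤ) →ₗ[ℤ] ({p // p ≠ s (π p)} →₀ ℤ))
      (g : ({p // p ≠ s (π p)} →₀ ℤ) →ₗ[ℤ] (P →₀ ℤ)),
      f ∘ₗ g = LinearMap.id ∧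
      (∀ m ∈ Set.range fun i ↦ ∑ p, if π p = i then Finsupp.single p (1 : ℤ) else 0, f m = 0) ∧
      ∀ m, m - g (f m) ∈ Submodule.span ℤ
        (Set.range fun i ↦ ∑ p, if π p = i then Finsupp.single p (1 : ℤ) else 0) := by
  let u (p : P) : {p // p ≠ s (π p)} →₀ ℤ :=
    if h : p ≠ s (π p) then Finsupp.single ⟨p, h⟩ 1 else 0
  let B (i : Fin k) : {p // p ≠ s (π p)} →₀ ℤ := ∑ p, if π p = i then u p else 0
  let f := Finsupp.linearCombination ℤ fun p ↦ u p - if p = s (π p) then B (π p) else 0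
  let g := Finsupp.linearCombination ℤ
    fun q : {p // p ≠ s (π p)} ↦ Finsupp.single (q : P) (1 : ℤ)
  have hf (p : P) : f (Finsupp.single p 1) = u p - if p = s (π p) then B (π p) else 0 := by
    simp [f]
  have hg (q : {p // p ≠ s (π p)}) : g (Finsupp.single q 1) = Finsupp.single (q : P) 1 := by
    simp [g]
  have hgu (p : P) : g (u p) = if p = s (π p) then 0 else Finsupp.single p 1 := by
    by_cases h : p = s (π p)
    · simp only [u, ne_eq, dif_neg (not_not.mpr h), if_pos h, map_zero]
    · simp only [u, ne_eq, dif_pos h, if_neg h, hg]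
  have key {M : Type} [AddCommGroup M] (c : P → M) (i : Fin k) :
      (∑ p, if π p = i then (if p = s (π p) then c p else 0) else 0) = c (s i) := by
    rw [Finset.sum_eq_single (s i)]
    · simp [hs]
    · intro p _ hp
      split_ifs with h1 h2
      · exact absurd (h1 ▸ h2) hp
      · rfl
      · rfl
    · simp
  refine ⟨f, g, ?_, ?_, ?_⟩
  · ext1 q
    ext1
    simp only [LinearMap.comp_apply, Finsupp.lsingle_apply, hg, hf, if_neg q.2, sub_zero,
      LinearMap.id_apply]
    simp only [u, dif_pos q.2]
  · rintro _ ⟨i, rfl⟩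
    have h : f (∑ p, if π p = i then Finsupp.single p (1 : ℤ) else 0) =
        B i - ∑ p, if π p = i then (if p = s (π p) then B (π p) else 0) else 0 := by
      simp only [B, map_sum, ← Finset.sum_sub_distrib]
      refine Finset.sum_congr rfl fun p _ ↦ ?_
      by_cases hp : π p = i
      · rw [if_pos hp, if_pos hp, if_pos hp, hf]
      · rw [if_neg hp, if_neg hp, if_neg hp, map_zero, sub_zero]
    rw [h, key (fun p ↦ B (π p)), hs, sub_self]
  · intro m
    induction m using Finsupp.induction_linear with
    | zero => simp
    | add a b ha hb =>
      rw [map_add, map_add, add_sub_add_comm]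
      exact add_mem ha hb
    | single p n =>
      rw [← mul_one n, ← smul_eq_mul, ← Finsupp.smul_single, map_smul, map_smul, ← smul_sub]
      refine Submodule.smul_mem _ n ?_
      by_cases h : p = s (π p)
      · refine Submodule.subset_span ⟨π p, ?_⟩
        have hgB : g (B (π p)) = (∑ q, if π q = π p then Finsupp.single q (1 : ℤ) else 0) -
            Finsupp.single p 1 := by
          conv_rhs => rw [h, hs, ← key (fun q ↦ Finsupp.single q (1 : ℤ)) (π p)]
          simp only [B, map_sum, ← Finset.sum_sub_distrib]
          refine Finset.sum_congr rfl fun q _ ↦ ?_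
          rw [apply_ite g, hgu, map_zero]
          split_ifs <;> simp
        rw [hf, if_pos h, map_sub, hgu, if_pos h, hgB]
        abel
      · rw [hf, if_neg h, sub_zero, hgu, if_neg h, sub_self]
        exact zero_mem _

theorem card_ne_section {P : Type} [Fintype P] [DecidableEq P] {k : ℕ} {π : P → Fin k}
    {s : Fin k → P} (hs : ∀ i, π (s i) = i) :
    Fintype.card {p // p ≠ s (π p)} = Fintype.card P - k := by
  have e : {p // p = s (π p)} ≃ Fin k :=
    { toFun := fun p ↦ π p
      invFun := fun i ↦ ⟨s i, by rw [hs]⟩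
      left_inv := fun p ↦ Subtype.ext p.2.symm
      right_inv := hs }
  rw [Fintype.card_subtype_compl, Fintype.card_congr e, Fintype.card_fin]

/-- for a surjection `π : P → Fin k` with `k ≥ 1`, the quotient of the
exterior algebra by the two-sided ideal generated by `α_0, …, α_{k-1}` is a free
`ℤ`-module of rank `2 ^ (card P - k)`. -/
theorem quotient_twoSided_alphas_free (P : Type) [Fintype P] [Nonempty P] (k : ℕ)
    (hk : 1 ≤ k) (π : P → Fin k) (hπ : Function.Surjective π) :
    Module.Free ℤ (Lam P ⧸ twoSidedSpanSet (Set.range (alph π))) ∧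
      Module.rank ℤ (Lam P ⧸ twoSidedSpanSet (Set.range (alph π))) =
        2 ^ (Fintype.card P - k) := by
  classical
  obtain ⟨s, hs⟩ := hπ.hasRightInverse
  obtain ⟨f, g, hfg, hS, hspan⟩ := exists_split_fiberSums hs
  have hrange : Set.range (alph π) = ExteriorAlgebra.ι ℤ ''
      Set.range fun i ↦ ∑ p, if π p = i then Finsupp.single p (1 : ℤ) else 0 := by
    rw [← Set.range_comp]
    congr 1
    ext1 i
    simp only [alph, yGen, Function.comp_apply, map_sum]
    exact Finset.sum_congr rfl fun p _ ↦ by split_ifs <;> simp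
  let F := (ExteriorAlgebra.map f).toRingHom.toAddMonoidHom.toIntLinearMap
  have hker : twoSidedSpanSet (Set.range (alph π)) = LinearMap.ker F := by
    ext x
    rw [hrange, mem_twoSidedSpanSet_iff_map_eq_zero f g hS hspan]
    rfl
  have hsurj : Function.Surjective F :=
    ExteriorAlgebra.map_surjective_iff.mpr fun n ↦ ⟨g n, LinearMap.congr_fun hfg n⟩
  let e := (Submodule.quotEquivOfEq _ _ hker).trans (F.quotKerEquivOfSurjective hsurj)
  let : LinearOrder {p // p ≠ s (π p)} := linearOrderOfSTO WellOrderingRel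
  let b := (Finsupp.basisSingleOne (R := ℤ) (ι := {p // p ≠ s (π p)})).ExteriorAlgebra
  let b' := b.map e.symm
  refine ⟨Module.Free.of_basis b', ?_⟩
  rw [rank_eq_card_basis b', Fintype.card_finset, card_ne_section hs]
  simp
end
end

section
/- Let P be a nonempty finite type, let k ≥ 1, and let π : P → Fin k be any function. For every i : Fin k and every w ∈ A with ω * w = 0, there exists v ∈ A with (α_i ⊗ 1) * w = ω * v. Equivalently, left multiplication by α_i ⊗ 1 maps the kernel of left multiplication by ω into its range, so it induces the zero endomorphism of the homology ker(ω·)/range(ω·). (This is part (1) of the paper's Lemma on the module structure of unlink homology: the Λ_p-action on Kh(L,p) descends to Λ_{p,L}.) -/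
open scoped TensorProduct

noncomputable section

/-- The ideal of squares of variables in `ℤ[x_0, …, x_{k-1}]`. -/
abbrev Bsq (k : ℕ) : Ideal (MvPolynomial (Fin k) ℤ) :=
  Ideal.span (Set.range fun i : Fin k => MvPolynomial.X i ^ 2)

/-- The algebra `B_k = ℤ[x_0, …, x_{k-1}]/(x_0², …, x_{k-1}²)`. -/
abbrev Bk (k : ℕ) : Type := MvPolynomial (Fin k) ℤ ⧸ Bsq k

/-- The class `x_i` of the `i`-th variable in `B_k`. -/
def xCls {k : ℕ} (i : Fin k) : Bk k := Ideal.Quotient.mk (Bsq k) (MvPolynomial.X i)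

/-- `A = Λ ⊗_ℤ B_k`. -/
abbrev Akh (P : Type) (k : ℕ) : Type := Lam P ⊗[ℤ] Bk k

/-- `ω = Σ_i α_i ⊗ x_i`. -/
def omegaEl {P : Type} [Fintype P] {k : ℕ} (π : P → Fin k) : Akh P k :=
  ∑ i : Fin k, alph π i ⊗ₜ[ℤ] xCls i

/-- The linear endomorphism of `ℤ[x_0, …, x_{k-1}]` lowering the exponent of `x_i` by one on
monomials in which it is odd, and killing the other monomials. -/
def lowerOdd {k : ℕ} (i : Fin k) : MvPolynomial (Fin k) ℤ →ₗ[ℤ] MvPolynomial (Fin k) ℤ :=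
  (MvPolynomial.basisMonomials (Fin k) ℤ).constr ℤ fun m =>
    if Odd (m i) then MvPolynomial.monomial (m - Finsupp.single i 1) 1 else 0

lemma lowerOdd_monomial {k : ℕ} (i : Fin k) (m : Fin k →₀ ℕ) :
    lowerOdd i (MvPolynomial.monomial m 1) =
      if Odd (m i) then MvPolynomial.monomial (m - Finsupp.single i 1) 1 else 0 := by
  have h := (MvPolynomial.basisMonomials (Fin k) ℤ).constr_basis ℤ (fun m : Fin k →₀ ℕ =>
    if Odd (m i) then (MvPolynomial.monomial (m - Finsupp.single i 1) 1 :
      MvPolynomial (Fin k) ℤ) else 0) m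
  rwa [MvPolynomial.coe_basisMonomials] at h

lemma lowerOdd_X_mul_self {k : ℕ} (i : Fin k) (p : MvPolynomial (Fin k) ℤ) :
    lowerOdd i (MvPolynomial.X i * p) = p - MvPolynomial.X i * lowerOdd i p := by
  suffices h : lowerOdd i ∘ₗ LinearMap.mulLeft ℤ (MvPolynomial.X i) =
      LinearMap.id - LinearMap.mulLeft ℤ (MvPolynomial.X i) ∘ₗ lowerOdd i from
    LinearMap.congr_fun h p
  refine (MvPolynomial.basisMonomials (Fin k) ℤ).ext fun m => ?_
  simp only [MvPolynomial.coe_basisMonomials, LinearMap.comp_apply, LinearMap.sub_apply,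
    LinearMap.mulLeft_apply, LinearMap.id_apply, MvPolynomial.X, MvPolynomial.monomial_mul,
    mul_one, lowerOdd_monomial]
  by_cases h : Odd (m i)
  · have h1 : ¬ Odd ((Finsupp.single i 1 + m : Fin k →₀ ℕ) i) := by
      simp only [Finsupp.add_apply, Finsupp.single_eq_same]
      grind
    have h2 : Finsupp.single i 1 + (m - Finsupp.single i 1) = m :=
      add_tsub_cancel_of_le (Finsupp.single_le_iff.2 h.pos)
    rw [if_neg h1, if_pos h, MvPolynomial.monomial_mul, h2, mul_one, sub_self]
  · have h1 : Odd ((Finsupp.single i 1 + m : Fin k →₀ ℕ) i) := by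
      simp only [Finsupp.add_apply, Finsupp.single_eq_same]
      grind
    rw [if_pos h1, if_neg h, mul_zero, sub_zero, add_tsub_cancel_left]

lemma lowerOdd_X_mul_of_ne {k : ℕ} {i j : Fin k} (hij : j ≠ i) (p : MvPolynomial (Fin k) ℤ) :
    lowerOdd i (MvPolynomial.X j * p) = MvPolynomial.X j * lowerOdd i p := by
  suffices h : lowerOdd i ∘ₗ LinearMap.mulLeft ℤ (MvPolynomial.X j) =
      LinearMap.mulLeft ℤ (MvPolynomial.X j) ∘ₗ lowerOdd i from
    LinearMap.congr_fun h p
  refine (MvPolynomial.basisMonomials (Fin k) ℤ).ext fun m => ?_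
  simp only [MvPolynomial.coe_basisMonomials, LinearMap.comp_apply,
    LinearMap.mulLeft_apply, MvPolynomial.X, MvPolynomial.monomial_mul,
    mul_one, lowerOdd_monomial]
  have h1 : (Finsupp.single j 1 + m : Fin k →₀ ℕ) i = m i := by
    simp [Finsupp.single_eq_of_ne' hij]
  rw [h1]
  split_ifs with h
  · rw [MvPolynomial.monomial_mul, mul_one,
      add_tsub_assoc_of_le (Finsupp.single_le_iff.2 h.pos)]
  · rw [mul_zero]

lemma lowerOdd_X_sq_mul {k : ℕ} (i j : Fin k) (p : MvPolynomial (Fin k) ℤ) :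
    lowerOdd i (MvPolynomial.X j ^ 2 * p) = MvPolynomial.X j ^ 2 * lowerOdd i p := by
  rw [sq, mul_assoc, mul_assoc]
  rcases eq_or_ne j i with rfl | h
  · rw [lowerOdd_X_mul_self, lowerOdd_X_mul_self]
    ring
  · rw [lowerOdd_X_mul_of_ne h, lowerOdd_X_mul_of_ne h]

lemma lowerOdd_mem_Bsq {k : ℕ} (i : Fin k) {p : MvPolynomial (Fin k) ℤ} (hp : p ∈ Bsq k) :
    lowerOdd i p ∈ Bsq k := by
  obtain ⟨c, rfl⟩ := Ideal.mem_span_range_iff_exists_fun.1 hp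
  rw [map_sum]
  refine Ideal.sum_mem _ fun j _ => ?_
  rw [mul_comm, lowerOdd_X_sq_mul]
  exact Ideal.mul_mem_right _ _ (Ideal.subset_span ⟨j, rfl⟩)

/-- `B_k` carries a contracting homotopy for multiplication by `x_i` that commutes with the other
variables. -/
lemma exists_homotopy_xCls {k : ℕ} (i : Fin k) :
    ∃ D : Bk k →ₗ[ℤ] Bk k, (∀ b, D (xCls i * b) = b - xCls i * D b) ∧
      ∀ j, j ≠ i → ∀ b, D (xCls j * b) = xCls j * D b := by
  let D : Bk k →+ Bk k := QuotientAddGroup.map (Bsq k).toAddSubgroup (Bsq k).toAddSubgroup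
    (lowerOdd i).toAddMonoidHom fun _ hp => lowerOdd_mem_Bsq i hp
  have hD (p : MvPolynomial (Fin k) ℤ) :
      D (Ideal.Quotient.mk (Bsq k) p) = Ideal.Quotient.mk (Bsq k) (lowerOdd i p) := rfl
  refine ⟨D.toIntLinearMap, fun b => ?_, fun j hj b => ?_⟩
  · obtain ⟨p, rfl⟩ := Ideal.Quotient.mk_surjective b
    simp only [AddMonoidHom.coe_toIntLinearMap, xCls, ← map_mul, hD, lowerOdd_X_mul_self, map_sub]
  · obtain ⟨p, rfl⟩ := Ideal.Quotient.mk_surjective b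
    simp only [AddMonoidHom.coe_toIntLinearMap, xCls, ← map_mul, hD, lowerOdd_X_mul_of_ne hj]

/-- The vector `Σ_{p : π p = i} e_p` underlying `α_i`. -/
def alphVec {P : Type} [Fintype P] {k : ℕ} (π : P → Fin k) (i : Fin k) : P →₀ ℤ :=
  ∑ p : P, if π p = i then Finsupp.single p 1 else 0

lemma ι_alphVec {P : Type} [Fintype P] {k : ℕ} (π : P → Fin k) (i : Fin k) :
    ExteriorAlgebra.ι ℤ (alphVec π i) = alph π i := by
  simp only [alphVec, alph, yGen, map_sum, apply_ite (ExteriorAlgebra.ι ℤ), map_zero]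

lemma alphVec_apply {P : Type} [Fintype P] {k : ℕ} (π : P → Fin k) (i : Fin k) (q : P) :
    alphVec π i q = if π q = i then 1 else 0 := by
  classical
  rw [alphVec, Finsupp.finsetSum_apply, Finset.sum_eq_single q]
  · split_ifs <;> simp
  · intro p _ hp
    split_ifs <;> simp [Finsupp.single_eq_of_ne' hp]
  · simp

/-- Reflections along `v` act trivially after multiplication by `v` in the exterior algebra. -/
lemma ExteriorAlgebra.ι_mul_map_eq {R M : Type*} [CommRing R] [AddCommGroup M] [Module R M]
    (v : M) (f : M →ₗ[R] M) (hf : ∀ m, ∃ c : R, f m = m + c • v) (a : ExteriorAlgebra R M) :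
    ExteriorAlgebra.ι R v * ExteriorAlgebra.map f a = ExteriorAlgebra.ι R v * a := by
  induction a using CliffordAlgebra.left_induction with
  | algebraMap r => rw [AlgHom.commutes]
  | add x y hx hy => rw [map_add, mul_add, mul_add, hx, hy]
  | ι_mul x m hx =>
    change ι R v * map f (ι R m * x) = ι R v * (ι R m * x)
    obtain ⟨c, hc⟩ := hf m
    have hanti : ι R v * ι R m = -(ι R m * ι R v) :=
      eq_neg_of_add_eq_zero_left (ExteriorAlgebra.ι_add_mul_swap v m)
    have hv : ι R v * ι R (f m) = ι R v * ι R m := by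
      rw [hc, map_add, map_smul, mul_add, mul_smul_comm, ExteriorAlgebra.ι_sq_zero, smul_zero,
        add_zero]
    rw [map_mul, ExteriorAlgebra.map_apply_ι, ← mul_assoc, hv, hanti, neg_mul, mul_assoc, hx,
      ← mul_assoc, ← neg_mul, ← hanti, mul_assoc]

lemma exists_reflection_alph {P : Type} [Fintype P] {k : ℕ} (π : P → Fin k) (i : Fin k) :
    ∃ τ : Lam P →ₐ[ℤ] Lam P, τ (alph π i) = -alph π i ∧
      (∀ j, j ≠ i → τ (alph π j) = alph π j) ∧ ∀ a, alph π i * τ a = alph π i * a := by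
  by_cases h : ∃ q, π q = i
  · obtain ⟨q, hq⟩ := h
    let f : (P →₀ ℤ) →ₗ[ℤ] (P →₀ ℤ) :=
      LinearMap.id - (Finsupp.lapply q).smulRight ((2 : ℤ) • alphVec π i)
    have hf (m : P →₀ ℤ) : f m = m - m q • (2 : ℤ) • alphVec π i := rfl
    refine ⟨ExteriorAlgebra.map f, ?_, fun j hj => ?_, fun a => ?_⟩
    · rw [← ι_alphVec, ExteriorAlgebra.map_apply_ι, ← map_neg, hf, alphVec_apply, if_pos hq]
      congr 1
      module
    · rw [← ι_alphVec, ExteriorAlgebra.map_apply_ι, hf, alphVec_apply,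
        if_neg (hq.trans_ne hj.symm), zero_smul, sub_zero]
    · rw [← ι_alphVec]
      refine ExteriorAlgebra.ι_mul_map_eq _ f (fun m => ⟨-(m q * 2), ?_⟩) a
      rw [hf]
      module
  · have h0 : alph π i = 0 :=
      Finset.sum_eq_zero fun p _ => if_neg fun hp => h ⟨p, hp⟩
    exact ⟨AlgHom.id ℤ _, by simp [h0], fun _ _ => rfl, fun _ => rfl⟩

/-- In a tensor product of algebras, if twisted contractions `τ` and `D` are available for the
`i`-th summand of `ω = Σ_j α_j ⊗ x_j` and commute with the other summands, then multiplication by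
`α_i ⊗ 1` is null-homotopic with respect to multiplication by `ω`. -/
lemma tmul_one_mul_eq_of_contraction {R Λ B ι : Type*} [CommRing R] [Ring Λ] [Algebra R Λ]
    [Ring B] [Algebra R B] [Fintype ι] (α : ι → Λ) (x : ι → B) (i : ι)
    (τ : Λ →ₗ[R] Λ) (D : B →ₗ[R] B)
    (hτi : ∀ a, τ (α i * a) = -(α i * a)) (hτ : ∀ a, α i * τ a = α i * a)
    (hτj : ∀ j, j ≠ i → ∀ a, τ (α j * a) = α j * τ a)
    (hDi : ∀ b, D (x i * b) = b - x i * D b)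
    (hDj : ∀ j, j ≠ i → ∀ b, D (x j * b) = x j * D b) (w : Λ ⊗[R] B) :
    (α i ⊗ₜ[R] (1 : B)) * w =
      (∑ j, α j ⊗ₜ[R] x j) * TensorProduct.map τ D w -
        TensorProduct.map τ D ((∑ j, α j ⊗ₜ[R] x j) * w) := by
  induction w using TensorProduct.induction_on with
  | zero => simp
  | add x y hx hy => simp only [mul_add, map_add, hx, hy]; abel
  | tmul a b =>
    simp only [Finset.sum_mul, map_sum, Algebra.TensorProduct.tmul_mul_tmul,
      TensorProduct.map_tmul, one_mul]
    rw [← Finset.sum_sub_distrib, Finset.sum_eq_single i]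
    · rw [hτi, hDi, hτ, TensorProduct.neg_tmul, TensorProduct.tmul_sub]
      abel
    · intro j _ hj
      rw [hτj j hj, hDj j hj, sub_self]
    · simp

lemma exists_tmul_one_mul_eq_of_contraction {R Λ B ι : Type*} [CommRing R] [Ring Λ]
    [Algebra R Λ] [Ring B] [Algebra R B] [Fintype ι] (α : ι → Λ) (x : ι → B) (i : ι)
    (τ : Λ →ₗ[R] Λ) (D : B →ₗ[R] B)
    (hτi : ∀ a, τ (α i * a) = -(α i * a)) (hτ : ∀ a, α i * τ a = α i * a)
    (hτj : ∀ j, j ≠ i → ∀ a, τ (α j * a) = α j * τ a)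
    (hDi : ∀ b, D (x i * b) = b - x i * D b)
    (hDj : ∀ j, j ≠ i → ∀ b, D (x j * b) = x j * D b) (w : Λ ⊗[R] B)
    (hw : (∑ j, α j ⊗ₜ[R] x j) * w = 0) :
    ∃ v : Λ ⊗[R] B, (α i ⊗ₜ[R] (1 : B)) * w = (∑ j, α j ⊗ₜ[R] x j) * v :=
  ⟨TensorProduct.map τ D w, by
    rw [tmul_one_mul_eq_of_contraction α x i τ D hτi hτ hτj hDi hDj, hw, map_zero, sub_zero]⟩

/-- left multiplication by `α_i ⊗ 1` maps the kernel of left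
multiplication by `ω` into its range, hence induces zero on homology. -/
theorem alpha_action_lands_in_range (P : Type) [Fintype P] [Nonempty P] (k : ℕ)
    (hk : 1 ≤ k) (π : P → Fin k) :
    ∀ (i : Fin k) (w : Akh P k), omegaEl π * w = 0 →
      ∃ v : Akh P k, (alph π i ⊗ₜ[ℤ] (1 : Bk k)) * w = omegaEl π * v := by
  intro i w hw
  obtain ⟨D, hDi, hDj⟩ := exists_homotopy_xCls i
  obtain ⟨τ, hτi, hτj, hτ⟩ := exists_reflection_alph π i
  exact @exists_tmul_one_mul_eq_of_contraction ℤ (Lam P) (Bk k) (Fin k) _ _ (Ring.toIntAlgebra _) _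
    (Ring.toIntAlgebra _) _ (alph π) xCls i τ.toRingHom.toAddMonoidHom.toIntLinearMap
    D.toAddMonoidHom.toIntLinearMap (fun a => (map_mul τ _ _).trans (by rw [hτi, neg_mul, hτ])) hτ
    (fun j hj a => (map_mul τ _ _).trans (by rw [hτj j hj]; rfl)) hDi hDj w hw
end
end

section
/- Let P be a nonempty finite type, let k ≥ 1, and let π : P → Fin k be any function. For every p ∈ P and every w ∈ A, one has y_p^*(ω * w) + ω * y_p^*(w) = (1 ⊗ x_{π(p)}) * w. In particular, left multiplication by 1 ⊗ x_{π(p)} on A is null-homotopic with explicit homotopy y_p^*, hence induces the zero endomorphism of ker(ω·)/range(ω·). (This is the homotopy H_p of Section 2.6 of the paper, specialized to the pointed Khovanov complex of an unlink.) -/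
open scoped TensorProduct

noncomputable section

/-- The contraction (interior product) `y_p^*` on the exterior algebra: the unique
`ℤ`-linear antiderivation sending `y_q` to `1` if `q = p` and to `0` otherwise. -/
def yStar {P : Type} (p : P) : Lam P →ₗ[ℤ] Lam P :=
  CliffordAlgebra.contractLeft (Q := (0 : QuadraticForm ℤ (P →₀ ℤ))) (Finsupp.lapply p)

/-- The extension `y_p^* ⊗ id` of the contraction to `A = Λ ⊗ B_k`. -/
def yStarA {P : Type} (p : P) (k : ℕ) : Akh P k →ₗ[ℤ] Akh P k :=
  LinearMap.rTensor (Bk k) (yStar p)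

/-- The operator `ζ_p : A → A`, `ζ_p(w) = (1 ⊗ x_{π p}) * y_p^*(w)`. -/
def zetaP {P : Type} [Fintype P] {k : ℕ} (π : P → Fin k) (p : P) (w : Akh P k) : Akh P k :=
  ((1 : Lam P) ⊗ₜ[ℤ] xCls (π p)) * yStarA p k w

theorem yStar_yGen_mul_add {P : Type} [DecidableEq P] (p q : P) (a : Lam P) :
    yStar p (yGen q * a) + yGen q * yStar p a = if q = p then a else 0 := by
  have h : yStar p (yGen q * a) =
      (Finsupp.single q (1 : ℤ)) p • a - yGen q * yStar p a :=
    CliffordAlgebra.contractLeft_ι_mul _ _ _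
  rw [h, sub_add_cancel, Finsupp.single_apply, ite_smul, one_smul, zero_smul]

theorem yStar_alph_mul_add {P : Type} [Fintype P] {k : ℕ} (π : P → Fin k) (p : P) (i : Fin k)
    (a : Lam P) :
    yStar p (alph π i * a) + alph π i * yStar p a = if π p = i then a else 0 := by
  classical
  simp only [alph, Finset.sum_mul, map_sum, ← Finset.sum_add_distrib]
  rw [Finset.sum_eq_single p]
  · split_ifs
    · rw [yStar_yGen_mul_add, if_pos rfl]
    · simp
  · intro q _ hq
    split_ifs
    · rw [yStar_yGen_mul_add, if_neg hq]
    · simp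
  · simp

theorem yStarA_tmul {P : Type} (p : P) {k : ℕ} (a : Lam P) (b : Bk k) :
    yStarA p k (a ⊗ₜ[ℤ] b) = yStar p a ⊗ₜ[ℤ] b :=
  LinearMap.rTensor_tmul _ _ _ _

/-- Multiplication of `A` as a bilinear map: typeclass search finds `Mul (Akh P k)` but no
distributivity for it. -/
def mulA (P : Type) (k : ℕ) : Akh P k →ₗ[ℤ] Akh P k →ₗ[ℤ] Akh P k :=
  Algebra.TensorProduct.mul

theorem mulA_apply {P : Type} {k : ℕ} (u v : Akh P k) : mulA P k u v = u * v := rfl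

theorem mulA_tmul_tmul {P : Type} {k : ℕ} (a c : Lam P) (b d : Bk k) :
    mulA P k (a ⊗ₜ[ℤ] b) (c ⊗ₜ[ℤ] d) = (a * c) ⊗ₜ[ℤ] (b * d) :=
  Algebra.TensorProduct.tmul_mul_tmul _ _ _ _

/-- the contraction `y_p^*` is a null-homotopy for left multiplication
by `1 ⊗ x_{π p}`: for all `w ∈ A`, `y_p^*(ω w) + ω y_p^*(w) = (1 ⊗ x_{π p}) w`. -/
theorem contraction_homotopy (P : Type) [Fintype P] [Nonempty P] (k : ℕ) (hk : 1 ≤ k)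
    (π : P → Fin k) :
    ∀ (p : P) (w : Akh P k),
      yStarA p k (omegaEl π * w) + omegaEl π * yStarA p k w =
        ((1 : Lam P) ⊗ₜ[ℤ] xCls (π p)) * w := by
  intro p w
  simp only [← mulA_apply]
  induction w using TensorProduct.induction_on with
  | zero => simp only [map_zero, add_zero]
  | add u v hu hv => simp only [map_add, ← hu, ← hv]; abel
  | tmul a b =>
    simp only [omegaEl, map_sum, LinearMap.sum_apply, mulA_tmul_tmul, yStarA_tmul,
      ← Finset.sum_add_distrib, ← TensorProduct.add_tmul, yStar_alph_mul_add, one_mul]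
    rw [Finset.sum_eq_single (π p)]
    · rw [if_pos rfl]
    · intro i _ hi
      rw [if_neg hi.symm, TensorProduct.zero_tmul]
    · simp
end
end

section
/- Let P be a nonempty finite type, let k ≥ 1, and let π : P → Fin k be any function. For every p ∈ P and every w ∈ A, one has ζ_p(ω * w) + ω * ζ_p(w) = 0; that is, the operator ζ_p anticommutes with the differential (left multiplication by ω) and hence induces a well-defined endomorphism of the homology ker(ω·)/range(ω·). (This is the chain-map property of the basepoint operators ζ_p from Section 2.6 of the paper, which generate the Γ-action on the Khovanov homology of a pointed unlink.) -/
open scoped TensorProduct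

noncomputable section

/-- In `CliffordAlgebra Q ⊗ B`, the contraction with `d` followed by multiplication by `1 ⊗ x`
anticommutes with left multiplication by `∑ i ∈ s, m i ⊗ b i` as soon as `x` annihilates
`d (m i) • b i` for all `i ∈ s`. -/
theorem CliffordAlgebra.tmul_rTensor_contractLeft_anticomm {R M B κ : Type*} [CommRing R]
    [AddCommGroup M] [Module R M] [CommRing B] [Algebra R B] (Q : QuadraticForm R M)
    (d : Module.Dual R M) (x : B) (s : Finset κ) (m : κ → M) (b : κ → B)
    (h : ∀ i ∈ s, d (m i) • (x * b i) = 0) (w : CliffordAlgebra Q ⊗[R] B) :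
    (1 ⊗ₜ[R] x) * (contractLeft d).rTensor B ((∑ i ∈ s, ι Q (m i) ⊗ₜ[R] b i) * w) +
      (∑ i ∈ s, ι Q (m i) ⊗ₜ[R] b i) * ((1 ⊗ₜ[R] x) * (contractLeft d).rTensor B w) = 0 := by
  induction w using TensorProduct.induction_on with
  | zero => simp
  | tmul a c =>
    simp only [Finset.sum_mul, map_sum, Finset.mul_sum, ← Finset.sum_add_distrib]
    refine Finset.sum_eq_zero fun i hi => ?_
    simp only [Algebra.TensorProduct.tmul_mul_tmul, LinearMap.rTensor_tmul, one_mul,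
      contractLeft_ι_mul]
    rw [mul_left_comm (b i), ← TensorProduct.add_tmul, sub_add_cancel, TensorProduct.smul_tmul,
      ← mul_assoc, ← smul_mul_assoc, h i hi, zero_mul, TensorProduct.tmul_zero]
  | add v w hv hw =>
    rw [mul_add, map_add, mul_add, map_add, mul_add, mul_add, add_add_add_comm, hv, hw, add_zero]

lemma xCls_mul_self {k : ℕ} (i : Fin k) : xCls i * xCls i = 0 := by
  rw [xCls, ← map_mul, Ideal.Quotient.eq_zero_iff_mem, ← pow_two]
  exact Ideal.subset_span ⟨i, rfl⟩

lemma alph_eq_ι {P : Type} [Fintype P] {k : ℕ} (π : P → Fin k) (i : Fin k) :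
    alph π i = ExteriorAlgebra.ι ℤ (∑ p : P, if π p = i then Finsupp.single p 1 else 0) := by
  simp only [alph, yGen, map_sum, apply_ite (ExteriorAlgebra.ι ℤ), map_zero]

lemma lapply_sum_ite_single {P : Type} [Fintype P] {k : ℕ} (π : P → Fin k) (p : P) (i : Fin k) :
    (Finsupp.lapply p : (P →₀ ℤ) →ₗ[ℤ] ℤ)
      (∑ q : P, if π q = i then Finsupp.single q 1 else 0) = if π p = i then 1 else 0 := by
  classical
  rw [map_sum, Finset.sum_eq_single p]
  · split_ifs <;> simp
  · intro q _ hq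
    split_ifs <;> simp [hq.symm]
  · simp

/-- the operator `ζ_p` anticommutes with left multiplication by `ω`:
`ζ_p(ω w) + ω ζ_p(w) = 0`, so it induces an endomorphism of the homology. -/
theorem zeta_anticommutes_with_differential (P : Type) [Fintype P] [Nonempty P] (k : ℕ)
    (hk : 1 ≤ k) (π : P → Fin k) :
    ∀ (p : P) (w : Akh P k),
      zetaP π p (omegaEl π * w) + omegaEl π * zetaP π p w = 0 := by
  intro p w
  have h : ∀ i ∈ Finset.univ, (Finsupp.lapply p : (P →₀ ℤ) →ₗ[ℤ] ℤ)
      (∑ q : P, if π q = i then Finsupp.single q 1 else 0) • (xCls (π p) * xCls i) = 0 := by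
    intro i _
    rw [lapply_sum_ite_single]
    split_ifs with hi
    · rw [hi, xCls_mul_self, smul_zero]
    · rw [zero_smul]
  have key := CliffordAlgebra.tmul_rTensor_contractLeft_anticomm
    (0 : QuadraticForm ℤ (P →₀ ℤ)) (Finsupp.lapply p) (xCls (π p)) Finset.univ _ xCls h w
  have hω : omegaEl π = ∑ i : Fin k, CliffordAlgebra.ι (0 : QuadraticForm ℤ (P →₀ ℤ))
      (∑ q : P, if π q = i then Finsupp.single q 1 else 0) ⊗ₜ[ℤ] xCls i := by
    simp only [omegaEl, alph_eq_ι]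
  rw [← hω] at key
  exact key
end
end

section
/- Let P be a nonempty finite type, let k ≥ 1, and let π : P → Fin k be any function. Suppose p, q ∈ P satisfy π(p) = π(q). Define H : A → A by H(w) = y_p^*(y_q^*(w)). Then for all w ∈ A, H(ω * w) − ω * H(w) = ζ_p(w) − ζ_q(w). In particular, ζ_p and ζ_q induce the same endomorphism of the homology ker(ω·)/range(ω·). (This is part (3) of the paper's Lemma on the module structure of unlink homology: basepoint operators associated to points on the same component agree on homology.) -/
open scoped TensorProduct

noncomputable section

/-- `α_i` has degree one, and pairs with the dual functional of `y_p` to `1` or `0`. -/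
lemma yStar_alph_mul {P : Type} [Fintype P] {k : ℕ} (π : P → Fin k) (p : P) (i : Fin k)
    (b : Lam P) :
    yStar p (alph π i * b) = (if π p = i then (1 : ℤ) else 0) • b - alph π i * yStar p b := by
  classical
  have h : alph π i =
      ExteriorAlgebra.ι ℤ (∑ r : P, if π r = i then Finsupp.single r (1 : ℤ) else 0) := by
    simp only [alph, yGen, map_sum, apply_ite (ExteriorAlgebra.ι ℤ), map_zero]
  have hp : Finsupp.lapply (R := ℤ) p
      (∑ r : P, if π r = i then Finsupp.single r (1 : ℤ) else 0) = if π p = i then 1 else 0 := by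
    rw [map_sum, Finset.sum_eq_single p]
    · split_ifs <;> simp
    · intro r _ hr
      split_ifs <;> simp [hr]
    · simp
  rw [h]
  refine (CliffordAlgebra.contractLeft_ι_mul (Q := (0 : QuadraticForm ℤ (P →₀ ℤ)))
    _ _ _).trans ?_
  rw [hp]
  rfl

section Ring

variable {L B ι : Type*} [Ring L] [CommRing B] [Fintype ι]

/-- If `d` is a `ℤ`-linear map such that `d (α i * a) = ε i • a - α i * d a`, then the anticommutator
of `d ⊗ id` with multiplication by `∑ i, α i ⊗ x i` is multiplication by `1 ⊗ ∑ i, ε i • x i`. -/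
lemma rTensor_sum_tmul_mul (d : L →ₗ[ℤ] L) (α : ι → L) (x : ι → B) (ε : ι → ℤ)
    (hd : ∀ i a, d (α i * a) = ε i • a - α i * d a) (w : L ⊗[ℤ] B) :
    d.rTensor B ((∑ i, α i ⊗ₜ[ℤ] x i) * w) =
      ((1 : L) ⊗ₜ[ℤ] ∑ i, ε i • x i) * w - (∑ i, α i ⊗ₜ[ℤ] x i) * d.rTensor B w := by
  induction w using TensorProduct.induction_on with
  | zero => simp
  | add u v hu hv =>
    simp only [mul_add, map_add, hu, hv]
    abel
  | tmul a b =>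
    simp only [Finset.sum_mul, map_sum, LinearMap.rTensor_tmul,
      Algebra.TensorProduct.tmul_mul_tmul, hd, TensorProduct.sub_tmul, Finset.sum_sub_distrib,
      one_mul, TensorProduct.tmul_sum, TensorProduct.smul_tmul, smul_mul_assoc]

lemma rTensor_one_tmul_mul (d : L →ₗ[ℤ] L) (x : B) (w : L ⊗[ℤ] B) :
    d.rTensor B (((1 : L) ⊗ₜ[ℤ] x) * w) = ((1 : L) ⊗ₜ[ℤ] x) * d.rTensor B w := by
  induction w using TensorProduct.induction_on with
  | zero => simp
  | add u v hu hv => simp only [mul_add, map_add, hu, hv]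
  | tmul a b => simp [Algebra.TensorProduct.tmul_mul_tmul]

/-- Two antiderivations `d`, `d'` as in `rTensor_sum_tmul_mul` with the same anticommutator
`1 ⊗ c` are homotopic up to the factor `1 ⊗ c`, through their composite. -/
lemma rTensor_comp_sub (d d' : L →ₗ[ℤ] L) (α : ι → L) (x : ι → B) (ε ε' : ι → ℤ) (c : B)
    (hd : ∀ i a, d (α i * a) = ε i • a - α i * d a)
    (hd' : ∀ i a, d' (α i * a) = ε' i • a - α i * d' a)
    (hc : ∑ i, ε i • x i = c) (hc' : ∑ i, ε' i • x i = c) (w : L ⊗[ℤ] B) :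
    d.rTensor B (d'.rTensor B ((∑ i, α i ⊗ₜ[ℤ] x i) * w)) -
        (∑ i, α i ⊗ₜ[ℤ] x i) * d.rTensor B (d'.rTensor B w) =
      ((1 : L) ⊗ₜ[ℤ] c) * d.rTensor B w - ((1 : L) ⊗ₜ[ℤ] c) * d'.rTensor B w := by
  rw [rTensor_sum_tmul_mul d' α x ε' hd', map_sub, rTensor_one_tmul_mul,
    rTensor_sum_tmul_mul d α x ε hd, hc, hc']
  abel

end Ring

/-- if `π p = π q` then `H = y_p^* ∘ y_q^*` is a chain homotopy between
`ζ_p` and `ζ_q`: `H(ω w) - ω H(w) = ζ_p(w) - ζ_q(w)`.  In particular `ζ_p` and `ζ_q`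
induce the same endomorphism of the homology. -/
theorem zeta_same_component_homotopic (P : Type) [Fintype P] [Nonempty P] (k : ℕ)
    (hk : 1 ≤ k) (π : P → Fin k) (p q : P) (hpq : π p = π q) :
    ∀ w : Akh P k,
      yStarA p k (yStarA q k (omegaEl π * w)) - omegaEl π * yStarA p k (yStarA q k w) =
        zetaP π p w - zetaP π q w := by
  intro w
  rw [zetaP, zetaP, ← hpq]
  exact rTensor_comp_sub (yStar p) (yStar q) (alph π) xCls
    (fun i => if π p = i then 1 else 0) (fun i => if π q = i then 1 else 0) (xCls (π p))
    (yStar_alph_mul π p) (yStar_alph_mul π q) (by simp) (by simp [hpq]) w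
end
end

section
/- Let R be a commutative ring, let C be a (ℤ-indexed) cochain complex of R-modules, and let f : C ⟶ C be a chain map. The commutative square with f as both horizontal arrows and f as both vertical arrows induces a chain map F : mappingCone(f) ⟶ mappingCone(f) between mapping cones. Then the mapping cone of F is isomorphic, as a cochain complex of R-modules, to the direct sum of mappingCone(f) and a shift by one of mappingCone(f). (This is the algebraic core of the paper's Lemma that iterating the mapping cone construction over two equal basepoint actions splits: it underlies the doubling isomorphism Kh(L,p) ≅ Kh(L, p ∖ {p₀}) ⊗ V when two basepoints lie on the same link component.) -/
open CategoryTheory CategoryTheory.Limits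

noncomputable section

namespace CochainComplex.mappingCone

open HomComplex

variable {A : Type*} [Category* A] [Abelian A]

/-- The retraction of `inr φ` given by a null-homotopy of `φ`. -/
def retractionOfHomotopyZero {K L : CochainComplex A ℤ} {φ : K ⟶ L} (h : Homotopy φ 0) :
    mappingCone φ ⟶ L :=
  desc φ (Cochain.ofHomotopy h) (𝟙 L) (by simp)

@[simp]
lemma inr_retractionOfHomotopyZero {K L : CochainComplex A ℤ} {φ : K ⟶ L}
    (h : Homotopy φ 0) : inr φ ≫ retractionOfHomotopyZero h = 𝟙 L :=
  inr_desc _ _ _ _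

/-- The mapping cone of a null-homotopic map splits as a biproduct. -/
def isoBiprodOfHomotopyZero {K L : CochainComplex A ℤ} {φ : K ⟶ L} (h : Homotopy φ 0) :
    mappingCone φ ≅ L ⊞ K⟦(1 : ℤ)⟧ :=
  (ShortComplex.Splitting.ofExactOfRetraction (triangleRotateShortComplex φ)
    (HomologicalComplex.shortExact_of_degreewise_shortExact _ fun n ↦
      (triangleRotateShortComplexSplitting φ n).shortExact).exact
    (retractionOfHomotopyZero h)
    (inr_retractionOfHomotopyZero h)
    (HomologicalComplex.shortExact_of_degreewise_shortExact _ fun n ↦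
      (triangleRotateShortComplexSplitting φ n).shortExact).epi_g).isoBinaryBiproduct

/-- The endomorphism of the mapping cone of `f : K ⟶ K` induced by `f` is null-homotopic. -/
def homotopyMapSelfZero {K : CochainComplex A ℤ} (f : K ⟶ K) :
    Homotopy (map f f f f rfl) 0 :=
  descHomotopy f _ _ 0 (inl f) (by simp [map]) (by simp [map])

end CochainComplex.mappingCone

/-- for a chain map `f : C ⟶ C` of cochain complexes of `R`-modules, the
chain map `F : mappingCone f ⟶ mappingCone f` induced by the commutative square with
`f` as both horizontal and both vertical arrows has mapping cone isomorphic to the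
direct sum of `mappingCone f` and a shift by one of `mappingCone f`. -/
theorem mappingCone_of_induced_map_splits (R : Type) [CommRing R]
    (C : CochainComplex (ModuleCat R) ℤ) (f : C ⟶ C) :
    Nonempty
      (CochainComplex.mappingCone
          (CochainComplex.mappingCone.map f f f f rfl) ≅
        CochainComplex.mappingCone f ⊞ (CochainComplex.mappingCone f)⟦(1 : ℤ)⟧) :=
  ⟨CochainComplex.mappingCone.isoBiprodOfHomotopyZero
    (CochainComplex.mappingCone.homotopyMapSelfZero f)⟩
end
end
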